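/- Let T be a monad on the category of sets, with finite alphabets being finite sets and finite T-algebras being those with finite universe. Then a class of T-languages is a syntactic language pseudovariety if and only if it is a polynomial language pseudovariety. -/

import Mathlib

universe u

structure SetMonad : Type (u + 1) where
  T : Type u → Type u
  map : {X Y : Type u} → (X → Y) → T X → T Y
  unit : {X : Type u} → X → T X
  mult : {X : Type u} → T (T X) → T X
  map_id : ∀ {X : Type u} (w : T X), map id w = w
  map_comp : ∀ {X Y Z : Type u} (g : Y → Z) (f : X → Y) (w : T X),
    map (g ∘ f) w = map g (map f w)
  unit_nat : ∀ {X Y : Type u} (f : X → Y) (x : X), map f (unit x) = unit (f x)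
  mult_nat : ∀ {X Y : Type u} (f : X → Y) (w : T (T X)),
    map f (mult w) = mult (map (map f) w)
  mult_unit : ∀ {X : Type u} (w : T X), mult (unit w) = w
  mult_map_unit : ∀ {X : Type u} (w : T X), mult (map unit w) = w
  mult_assoc : ∀ {X : Type u} (w : T (T (T X))), mult (mult w) = mult (map mult w)

structure SetMonad.Alg (M : SetMonad.{u}) : Type (u + 1) where
  carrier : Type u
  mul : M.T carrier → carrier
  mul_unit : ∀ a, mul (M.unit a) = a
  mul_assoc : ∀ w, mul (M.mult w) = mul (M.map mul w)

namespace SetMonad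

variable (M : SetMonad.{u})

/-- `h` is a morphism of Eilenberg–Moore `T`-algebras. -/
def IsHom (A B : M.Alg) (h : A.carrier → B.carrier) : Prop :=
  ∀ w, h (A.mul w) = B.mul (M.map h w)

/-- The free `T`-algebra on a set. -/
def Free (Sig : Type u) : M.Alg where
  carrier := M.T Sig
  mul := M.mult
  mul_unit := M.mult_unit
  mul_assoc := M.mult_assoc

/-- Unary polynomials over an algebra: elements of `T (A ⊕ {x})`. -/
def UPoly (A : M.Alg) : Type u := M.T (A.carrier ⊕ PUnit.{u + 1})

/-- Evaluation of a unary polynomial at a point. -/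
def evalPoly (A : M.Alg) (p : M.UPoly A) (a : A.carrier) : A.carrier :=
  A.mul (M.map (Sum.elim id fun _ => a) p)

/-- Polynomial derivative of a language. -/
def deriv {Sig : Type u} (p : M.UPoly (M.Free Sig)) (L : Set (M.T Sig)) : Set (M.T Sig) :=
  {w | M.evalPoly (M.Free Sig) p w ∈ L}

/-- A language is recognisable if it is a morphism preimage from a finite algebra. -/
def Recognisable (A : M.Alg) (L : Set A.carrier) : Prop :=
  ∃ (B : M.Alg) (h : A.carrier → B.carrier) (F : Set B.carrier),
    Finite B.carrier ∧ M.IsHom A B h ∧ L = h ⁻¹' F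

/-- `h` is a syntactic morphism of `L`. -/
def IsSynMorphism {Sig : Type u} (L : Set (M.T Sig)) (B : M.Alg)
    (h : M.T Sig → B.carrier) : Prop :=
  Finite B.carrier ∧ M.IsHom (M.Free Sig) B h ∧ Function.Surjective h ∧
    ∀ w w' : M.T Sig, h w = h w' ↔
      ∀ p : M.UPoly (M.Free Sig),
        (M.evalPoly (M.Free Sig) p w ∈ L ↔ M.evalPoly (M.Free Sig) p w' ∈ L)

/-- The product of two `T`-algebras. -/
def prodAlg (A B : M.Alg) : M.Alg where
  carrier := A.carrier × B.carrier
  mul w := (A.mul (M.map Prod.fst w), B.mul (M.map Prod.snd w))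
  mul_unit a := by
    show (A.mul (M.map Prod.fst (M.unit a)), B.mul (M.map Prod.snd (M.unit a))) = a
    rw [M.unit_nat, M.unit_nat, A.mul_unit, B.mul_unit]
  mul_assoc w := by
    show (A.mul (M.map Prod.fst (M.mult w)), B.mul (M.map Prod.snd (M.mult w))) = _
    rw [M.mult_nat, M.mult_nat, A.mul_assoc, B.mul_assoc,
      ← M.map_comp, ← M.map_comp]
    show _ = (A.mul (M.map Prod.fst (M.map _ w)), B.mul (M.map Prod.snd (M.map _ w)))
    rw [← M.map_comp, ← M.map_comp]
    rfl

/-- The subalgebra on a multiplication-closed subset. -/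
def subAlg (A : M.Alg) (S : Set A.carrier)
    (hS : ∀ w : M.T ↥S, A.mul (M.map Subtype.val w) ∈ S) : M.Alg where
  carrier := ↥S
  mul w := ⟨A.mul (M.map Subtype.val w), hS w⟩
  mul_unit a := by
    apply Subtype.ext
    show A.mul (M.map Subtype.val (M.unit a)) = a.val
    rw [M.unit_nat, A.mul_unit]
  mul_assoc w := by
    apply Subtype.ext
    show A.mul (M.map Subtype.val (M.mult w)) = A.mul (M.map Subtype.val (M.map _ w))
    rw [M.mult_nat, A.mul_assoc, ← M.map_comp, ← M.map_comp]
    rfl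

/-- A class of finite `T`-algebras is an algebra pseudovariety if it is closed under
binary products, surjective morphic images, and subalgebras. -/
def IsAlgPV (P : M.Alg → Prop) : Prop :=
  (∀ A, P A → Finite A.carrier) ∧
  (∀ A B, P A → P B → P (M.prodAlg A B)) ∧
  (∀ (A B : M.Alg) (h : A.carrier → B.carrier),
    P A → M.IsHom A B h → Function.Surjective h → P B) ∧
  (∀ (A : M.Alg) (S : Set A.carrier) (hS : ∀ w : M.T ↥S, A.mul (M.map Subtype.val w) ∈ S),
    P A → P (M.subAlg A S hS))

/-- All members of the class are T-languages: recognisable languages over finite alphabets. -/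
def IsLangClass (P : ∀ Sig : Type u, Set (M.T Sig) → Prop) : Prop :=
  ∀ (Sig : Type u) (L : Set (M.T Sig)), P Sig L → Finite Sig ∧ M.Recognisable (M.Free Sig) L

/-- Closure under Boolean combinations over a common alphabet. -/
def ClosedBool (P : ∀ Sig : Type u, Set (M.T Sig) → Prop) : Prop :=
  (∀ (Sig : Type u) (L K : Set (M.T Sig)), P Sig L → P Sig K → P Sig (L ∪ K)) ∧
  (∀ (Sig : Type u) (L K : Set (M.T Sig)), P Sig L → P Sig K → P Sig (L ∩ K)) ∧
  (∀ (Sig : Type u) (L : Set (M.T Sig)), P Sig L → P Sig Lᶜ)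

/-- Closure under preimages of `T`-morphisms between free algebras on finite alphabets. -/
def ClosedPreimage (P : ∀ Sig : Type u, Set (M.T Sig) → Prop) : Prop :=
  ∀ (Sig Gam : Type u) (L : Set (M.T Sig)) (h : M.T Gam → M.T Sig),
    Finite Gam → P Sig L → M.IsHom (M.Free Gam) (M.Free Sig) h → P Gam (h ⁻¹' L)

/-- Closure under polynomial derivatives. -/
def ClosedPolyDeriv (P : ∀ Sig : Type u, Set (M.T Sig) → Prop) : Prop :=
  ∀ (Sig : Type u) (L : Set (M.T Sig)) (p : M.UPoly (M.Free Sig)),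
    P Sig L → P Sig (M.deriv p L)

/-- Closure under syntactic derivatives: all languages recognised by a syntactic
morphism of a member. -/
def ClosedSynDeriv (P : ∀ Sig : Type u, Set (M.T Sig) → Prop) : Prop :=
  ∀ (Sig : Type u) (L : Set (M.T Sig)) (B : M.Alg) (h : M.T Sig → B.carrier)
    (F : Set B.carrier), P Sig L → M.IsSynMorphism L B h → P Sig (h ⁻¹' F)

/-- Syntactic language pseudovariety. -/
def IsSynLangPV (P : ∀ Sig : Type u, Set (M.T Sig) → Prop) : Prop :=
  M.IsLangClass P ∧ M.ClosedBool P ∧ M.ClosedPreimage P ∧ M.ClosedSynDeriv P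

/-- Polynomial language pseudovariety. -/
def IsPolyLangPV (P : ∀ Sig : Type u, Set (M.T Sig) → Prop) : Prop :=
  M.IsLangClass P ∧ M.ClosedBool P ∧ M.ClosedPreimage P ∧ M.ClosedPolyDeriv P

/-- The class of T-languages recognised by some algebra of the class `P`. -/
def makelang (P : M.Alg → Prop) : ∀ Sig : Type u, Set (M.T Sig) → Prop :=
  fun Sig L => Finite Sig ∧
    ∃ (B : M.Alg) (h : M.T Sig → B.carrier) (F : Set B.carrier),
      P B ∧ M.IsHom (M.Free Sig) B h ∧ L = h ⁻¹' F

/-- The class of finite `T`-algebras all of whose recognised languages belong to `P`. -/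
def makealg (P : ∀ Sig : Type u, Set (M.T Sig) → Prop) : M.Alg → Prop :=
  fun B => Finite B.carrier ∧
    ∀ (Sig : Type u) (h : M.T Sig → B.carrier) (F : Set B.carrier),
      Finite Sig → M.IsHom (M.Free Sig) B h → P Sig (h ⁻¹' F)

end SetMonad

namespace SetMonad

section PolynomialComposition

variable (M : SetMonad.{u}) (A : M.Alg)

/-- Substitution of a unary polynomial into another. -/
def compPoly (p r : M.UPoly A) : M.UPoly A :=
  let r' : M.T (A.carrier ⊕ PUnit.{u + 1}) := r
  M.mult (M.map (Sum.elim (fun a => M.unit (Sum.inl a)) fun _ => r') p)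

theorem evalPoly_compPoly (p r : M.UPoly A) (a : A.carrier) :
    M.evalPoly A (M.compPoly A p r) a = M.evalPoly A p (M.evalPoly A r a) := by
  change M.T (A.carrier ⊕ PUnit.{u + 1}) at p r
  unfold evalPoly compPoly
  rw [M.mult_nat, A.mul_assoc, ← M.map_comp, ← M.map_comp]
  congr 2
  funext s
  rcases s with s | s
  · simp [M.unit_nat, A.mul_unit]
  · rfl

theorem IsHom.map_evalPoly {M : SetMonad.{u}} {A B : M.Alg} {h : A.carrier → B.carrier}
    (hh : M.IsHom A B h) (p : M.UPoly A) (a : A.carrier) :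
    h (M.evalPoly A p a) = M.evalPoly B (M.map (Sum.map h id) p) (h a) := by
  change M.T (A.carrier ⊕ PUnit.{u + 1}) at p
  unfold evalPoly
  rw [hh, ← M.map_comp, ← M.map_comp]
  congr 2
  funext s
  rcases s with s | s <;> rfl

end PolynomialComposition

section SyntacticCongruence

variable {M : SetMonad.{u}} {A : M.Alg}

/-- The syntactic congruence of a subset of an algebra: indistinguishability by unary
polynomials. -/
def synSetoid (L : Set A.carrier) : Setoid A.carrier where
  r a b := ∀ p : M.UPoly A, M.evalPoly A p a ∈ L ↔ M.evalPoly A p b ∈ L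
  iseqv := ⟨fun _ _ => Iff.rfl, fun h p => (h p).symm, fun h k p => (h p).trans (k p)⟩

theorem synSetoid_evalPoly {L : Set A.carrier} {a b : A.carrier}
    (hab : synSetoid L a b) (r : M.UPoly A) :
    synSetoid L (M.evalPoly A r a) (M.evalPoly A r b) := fun p => by
  simpa only [evalPoly_compPoly] using hab (M.compPoly A p r)

theorem synSetoid_mul_update {L : Set A.carrier} {X : Type u} [DecidableEq X] (f : X → A.carrier)
    (x : X) {a b : A.carrier} (hab : synSetoid L a b) (w : M.T X) :
    synSetoid L (A.mul (M.map (Function.update f x a) w))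
      (A.mul (M.map (Function.update f x b) w)) := by
  have key (c : A.carrier) : A.mul (M.map (Function.update f x c) w) =
      M.evalPoly A
        (M.map (fun y => if y = x then Sum.inr PUnit.unit else Sum.inl (f y)) w) c := by
    unfold evalPoly
    rw [← M.map_comp]
    congr 2
    funext y
    by_cases hy : y = x <;> simp [hy]
  rw [key, key]
  exact synSetoid_evalPoly hab _

theorem synSetoid_mul_map {L : Set A.carrier} {X : Type u} [Finite X] {f g : X → A.carrier}
    (hfg : ∀ x, synSetoid L (f x) (g x)) (w : M.T X) :
    synSetoid L (A.mul (M.map f w)) (A.mul (M.map g w)) := by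
  classical
  have := Fintype.ofFinite X
  have key (S : Finset X) :
      synSetoid L (A.mul (M.map f w)) (A.mul (M.map (S.piecewise g f) w)) := by
    induction S using Finset.induction_on with
    | empty => simp
    | insert x S hx ih =>
      refine (synSetoid L).trans ih ?_
      have h := synSetoid_mul_update (S.piecewise g f) x (hfg x) w
      rwa [← Finset.piecewise_insert, ← Finset.piecewise_eq_of_notMem S g f hx,
        Function.update_eq_self] at h
  simpa using key Finset.univ

theorem IsHom.synSetoid_of_eq {B : M.Alg} {h : A.carrier → B.carrier} (hh : M.IsHom A B h)
    (F : Set B.carrier) {a b : A.carrier} (hab : h a = h b) : synSetoid (h ⁻¹' F) a b := fun p => by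
  rw [Set.mem_preimage, Set.mem_preimage, hh.map_evalPoly, hh.map_evalPoly, hab]

theorem IsHom.synSetoid_mul_map_of_fiberwise {B : M.Alg} [Finite B.carrier]
    {h : A.carrier → B.carrier} (hh : M.IsHom A B h) (F : Set B.carrier) (f : A.carrier → A.carrier)
    (hf : ∀ a, synSetoid (h ⁻¹' F) (f a) a) (hf' : ∀ a b, h a = h b → f a = f b)
    (w : M.T A.carrier) :
    synSetoid (h ⁻¹' F) (A.mul (M.map f w)) (A.mul w) := by
  let k : A.carrier → Set.range h := Set.rangeFactorization h
  let σ : Set.range h → A.carrier := fun y => y.2.choose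
  have hσ (a : A.carrier) : h (σ (k a)) = h a := (k a).2.choose_spec
  have hfac : f = (f ∘ σ) ∘ k := funext fun a => hf' _ _ (hσ a).symm
  have hstep := synSetoid_mul_map (L := h ⁻¹' F) (f := f ∘ σ) (g := σ) (fun y => hf (σ y)) (M.map k w)
  rw [← M.map_comp, ← M.map_comp, ← hfac] at hstep
  refine (synSetoid _).trans hstep (hh.synSetoid_of_eq F ?_)
  rw [hh, hh, ← M.map_comp]
  congr 2
  exact funext hσ

/-- The quotient algebra structure transported along a surjection with a section `s`, provided
that replacing elements by their chosen representatives does not affect products. -/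
def quotientAlg {Q : Type u} (q : A.carrier → Q) (s : Q → A.carrier) (hs : ∀ x, q (s x) = x)
    (hq : ∀ w, q (A.mul (M.map (s ∘ q) w)) = q (A.mul w)) : M.Alg where
  carrier := Q
  mul w := q (A.mul (M.map s w))
  mul_unit x := by rw [M.unit_nat, A.mul_unit, hs]
  mul_assoc w := by
    rw [M.mult_nat, A.mul_assoc, ← M.map_comp, ← M.map_comp, ← hq, ← M.map_comp]
    rfl

theorem exists_isSynMorphism {Sig : Type u} {L : Set (M.T Sig)}
    (hL : M.Recognisable (M.Free Sig) L) :
    ∃ (B : M.Alg) (h : M.T Sig → B.carrier), M.IsSynMorphism L B h := by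
  obtain ⟨B, h, F, hB, hh, rfl⟩ := hL
  let S := synSetoid (A := M.Free Sig) (h ⁻¹' F)
  let q : M.T Sig → Quotient S := Quotient.mk S
  have hq (w : M.T (M.T Sig)) :
      q (M.mult (M.map (Quotient.out ∘ q) w)) = q (M.mult w) := by
    refine Quotient.sound (hh.synSetoid_mul_map_of_fiberwise F (Quotient.out ∘ q)
      (fun a => Quotient.exact (Quotient.out_eq (q a))) (fun a b hab => ?_) w)
    exact congrArg Quotient.out (Quotient.sound (hh.synSetoid_of_eq F hab))
  refine ⟨quotientAlg (A := M.Free Sig) q Quotient.out Quotient.out_eq hq, q, ?_, ?_,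
    Quotient.mk_surjective, fun w w' => ⟨Quotient.exact, fun H => Quotient.sound H⟩⟩
  · refine Finite.of_injective (fun x : Quotient S => h x.out) fun x y hxy => ?_
    rw [← Quotient.out_eq x, ← Quotient.out_eq y]
    exact Quotient.sound (hh.synSetoid_of_eq F hxy)
  · intro w
    refine (hq w).symm.trans ?_
    exact congrArg (fun v => q (M.mult v)) (M.map_comp Quotient.out q w)

end SyntacticCongruence

section Closure

variable {M : SetMonad.{u}} {P : ∀ Sig : Type u, Set (M.T Sig) → Prop}

theorem ClosedSynDeriv.closedPolyDeriv (hP : M.IsLangClass P) (hS : M.ClosedSynDeriv P) :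
    M.ClosedPolyDeriv P := by
  intro Sig L p hL
  obtain ⟨B, h, hh⟩ := exists_isSynMorphism (hP Sig L hL).2
  have hsat : M.deriv p L = h ⁻¹' (h '' M.deriv p L) := by
    refine (Set.subset_preimage_image h _).antisymm ?_
    rintro w ⟨w', hw', hww'⟩
    exact ((hh.2.2.2 w' w).1 hww' p).1 hw'
  rw [hsat]
  exact hS Sig L B h _ hL hh

theorem ClosedBool.empty (hB : M.ClosedBool P) {Sig : Type u} {L : Set (M.T Sig)}
    (hL : P Sig L) : P Sig ∅ := by
  rw [← Set.inter_compl_self L]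
  exact hB.2.1 _ _ _ hL (hB.2.2 _ _ hL)

theorem ClosedBool.biUnion (hB : M.ClosedBool P) {Sig : Type u} {ι : Type*} (s : Finset ι)
    {K : ι → Set (M.T Sig)} (h0 : P Sig ∅) (hK : ∀ i, P Sig (K i)) : P Sig (⋃ i ∈ s, K i) := by
  classical
  induction s using Finset.induction_on with
  | empty => simpa using h0
  | insert i s _ ih =>
    rw [Finset.set_biUnion_insert]
    exact hB.1 _ _ _ (hK i) ih

theorem ClosedBool.iUnion (hB : M.ClosedBool P) {Sig : Type u} {ι : Type*} [Finite ι]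
    {K : ι → Set (M.T Sig)} (h0 : P Sig ∅) (hK : ∀ i, P Sig (K i)) : P Sig (⋃ i, K i) := by
  have := Fintype.ofFinite ι
  simpa using hB.biUnion Finset.univ h0 hK

theorem ClosedBool.iInter (hB : M.ClosedBool P) {Sig : Type u} {ι : Type*} [Finite ι]
    {K : ι → Set (M.T Sig)} (h0 : P Sig ∅) (hK : ∀ i, P Sig (K i)) : P Sig (⋂ i, K i) := by
  rw [Set.iInter_eq_compl_iUnion_compl]
  exact hB.2.2 _ _ (hB.iUnion h0 fun i => hB.2.2 _ _ (hK i))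

theorem ClosedBool.preimage_of_separating (hB : M.ClosedBool P) {Sig : Type u} {B : Type u}
    [Finite B] (h : M.T Sig → B) (h0 : P Sig ∅)
    (hsep : ∀ b c, b ≠ c → ∃ K, P Sig K ∧ h ⁻¹' {b} ⊆ K ∧ Disjoint K (h ⁻¹' {c})) (F : Set B) :
    P Sig (h ⁻¹' F) := by
  choose K hK hbK hKc using hsep
  have hEq : h ⁻¹' F = ⋃ b : F, ⋂ c : {c // (b : B) ≠ c}, K b c c.2 := by
    ext w
    simp only [Set.mem_preimage, Set.mem_iUnion, Set.mem_iInter]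
    constructor
    · exact fun hw => ⟨⟨h w, hw⟩, fun c => hbK _ _ c.2 rfl⟩
    · rintro ⟨b, hw⟩
      by_cases hb : (b : B) = h w
      · exact hb ▸ b.2
      · exact (Set.disjoint_left.1 (hKc _ _ hb) (hw ⟨h w, hb⟩) rfl).elim
  rw [hEq]
  exact hB.iUnion h0 fun b => hB.iInter h0 fun c => hK _ _ c.2

theorem ClosedPolyDeriv.closedSynDeriv (hB : M.ClosedBool P) (hD : M.ClosedPolyDeriv P) :
    M.ClosedSynDeriv P := by
  rintro Sig L B h F hL ⟨hfin, -, hsurj, hsyn⟩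
  refine hB.preimage_of_separating h (hB.empty hL) (fun b c hbc => ?_) F
  obtain ⟨w, rfl⟩ := hsurj b
  obtain ⟨v, rfl⟩ := hsurj c
  obtain ⟨p, hp⟩ := not_forall.1 (mt (hsyn w v).2 hbc)
  by_cases hw : M.evalPoly (M.Free Sig) p w ∈ L
  · refine ⟨_, hD Sig L p hL, fun x hx => ((hsyn x w).1 hx p).2 hw, ?_⟩
    rw [Set.disjoint_left]
    exact fun x hx hxv => hp (iff_of_true hw (((hsyn x v).1 hxv p).1 hx))
  · refine ⟨_, hB.2.2 _ _ (hD Sig L p hL), fun x hx hxL => hw (((hsyn x w).1 hx p).1 hxL), ?_⟩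
    rw [Set.disjoint_left]
    exact fun x hx hxv => hp (iff_of_false hw fun hv => hx (((hsyn x v).1 hxv p).2 hv))

end Closure

end SetMonad

/-- In the setting of sets (finite alphabets = finite sets, finite algebras = algebras
with finite universe), a class of T-languages is a syntactic language pseudovariety if
and only if it is a polynomial language pseudovariety. -/
theorem syntactic_eq_polynomial_pseudovariety (M : SetMonad.{u})
    (P : ∀ Sig : Type u, Set (M.T Sig) → Prop) :
    M.IsSynLangPV P ↔ M.IsPolyLangPV P := by
  constructor
  · rintro ⟨hL, hB, hh, hS⟩
    exact ⟨hL, hB, hh, hS.closedPolyDeriv hL⟩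
  · rintro ⟨hL, hB, hh, hD⟩
    exact ⟨hL, hB, hh, hD.closedSynDeriv hB⟩
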